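/- Let M be a module over V = W(m,n) or V = W(m,n) ⋉ A d_0. Then (a) Hom(A,M) is an AV-module with the actions (fφ)(g) = (−1)^{|f||φ|} φ(fg) and (ηφ)(g) = η·φ(g) − (−1)^{|η||φ|} φ(η(g)), for φ ∈ Hom(A,M), η ∈ V, f,g ∈ A; and (b) the map π: Hom(A,M) → M defined by π(φ) = φ(1) is a homomorphism of V-modules. -/

import Mathlib

open scoped BigOperators

namespace WSuper

noncomputable section

/-- Exponents of the Laurent (even) variables `t_1, …, t_m`. -/
abbrev LExp (m : ℕ) := Fin m → ℤ
/-- Exponents of the Grassmann (odd) variables `ξ_1, …, ξ_n`. -/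
abbrev GExp (n : ℕ) := Fin n → Bool

variable {m n : ℕ}

/-- Degree of a Grassmann monomial `ξ^s`. -/
def gdeg (s : GExp n) : ℕ := (Finset.univ.filter fun a => s a = true).card

/-- Number of inversions between `ξ^s` and `ξ^q`. -/
def invCount (s q : GExp n) : ℕ :=
  ((Finset.univ ×ˢ Finset.univ).filter
    fun p : Fin n × Fin n => s p.1 = true ∧ q p.2 = true ∧ p.2 < p.1).card

/-- The scalar `c` with `ξ^s · ξ^q = c · ξ^(s xor q)` in the exterior algebra. -/
def mulSgn (s q : GExp n) : ℂ :=
  if ∃ a, s a = true ∧ q a = true then 0 else (-1 : ℂ) ^ invCount s q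

/-- Exponent of the product of two (disjoint) Grassmann monomials. -/
def xorE (s q : GExp n) : GExp n := fun a => Bool.xor (s a) (q a)

/-- The scalar `c` with `∂_a (ξ^s) = c ξ^(s \ a)`. -/
def derC (a : Fin n) (s : GExp n) : ℂ :=
  if s a = true then (-1 : ℂ) ^ (Finset.univ.filter fun x => s x = true ∧ x < a).card else 0

/-- The exponent of `∂_a (ξ^s)`. -/
def derE (a : Fin n) (s : GExp n) : GExp n := Function.update s a false

/-- Directions: `d_i = t_i ∂/∂t_i`, `∂_α = ∂/∂ξ_α`, and (when `b = true`) the extra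
even direction `d_0` of `W(m,n) ⋉ A d_0`. -/
inductive Dir (m n : ℕ) : Bool → Type where
  | di {b : Bool} (i : Fin m) : Dir m n b
  | pa {b : Bool} (a : Fin n) : Dir m n b
  | d0 : Dir m n true

/-- The basis `t^r ξ^s D` of `W(m,n)` (for `b = false`) resp. of `W(m,n) ⋉ A d_0`
(for `b = true`). -/
abbrev WBasis (m n : ℕ) (b : Bool) := LExp m × GExp n × Dir m n b

/-- The Lie superalgebra `W(m,n)` (`b = false`) resp. `W(m,n) ⋉ A d_0` (`b = true`),
as the free complex vector space on its standard basis. -/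
abbrev W (m n : ℕ) (b : Bool) := WBasis m n b →₀ ℂ

def sng {b : Bool} (x : WBasis m n b) : W m n b := Finsupp.single x 1

/-- Parity (0 = even, 1 = odd) of a basis element. -/
def par {b : Bool} : WBasis m n b → ℕ
  | ⟨_, s, .di _⟩ => gdeg s % 2
  | ⟨_, s, .pa _⟩ => (gdeg s + 1) % 2
  | ⟨_, s, .d0⟩ => gdeg s % 2

/-- The super Lie bracket of `W(m,n)` (resp. `W(m,n) ⋉ A d_0`) on basis elements. -/
def brB {b : Bool} : WBasis m n b → WBasis m n b → W m n b
  | ⟨r, s, .di i⟩, ⟨p, q, .di j⟩ =>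
      ((p i : ℂ) * mulSgn s q) • sng ⟨r + p, xorE s q, .di j⟩
        - ((r j : ℂ) * mulSgn s q) • sng ⟨r + p, xorE s q, .di i⟩
  | ⟨r, s, .di i⟩, ⟨p, q, .pa β⟩ =>
      ((p i : ℂ) * mulSgn s q) • sng ⟨r + p, xorE s q, .pa β⟩
        - ((-1 : ℂ) ^ (gdeg s * (gdeg q + 1)) * derC β s * mulSgn q (derE β s)) •
            sng ⟨r + p, xorE q (derE β s), .di i⟩
  | ⟨r, s, .pa α⟩, ⟨p, q, .di j⟩ =>
      (derC α q * mulSgn s (derE α q)) • sng ⟨r + p, xorE s (derE α q), .di j⟩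
        - ((-1 : ℂ) ^ ((gdeg s + 1) * gdeg q) * (r j : ℂ) * mulSgn q s) •
            sng ⟨r + p, xorE q s, .pa α⟩
  | ⟨r, s, .pa α⟩, ⟨p, q, .pa β⟩ =>
      (derC α q * mulSgn s (derE α q)) • sng ⟨r + p, xorE s (derE α q), .pa β⟩
        - ((-1 : ℂ) ^ ((gdeg s + 1) * (gdeg q + 1)) * derC β s * mulSgn q (derE β s)) •
            sng ⟨r + p, xorE q (derE β s), .pa α⟩
  | ⟨r, s, .di i⟩, ⟨p, q, .d0⟩ =>
      ((p i : ℂ) * mulSgn s q) • sng ⟨r + p, xorE s q, .d0⟩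
  | ⟨r, s, .pa α⟩, ⟨p, q, .d0⟩ =>
      (derC α q * mulSgn s (derE α q)) • sng ⟨r + p, xorE s (derE α q), .d0⟩
  | ⟨r, s, .d0⟩, ⟨p, q, .di j⟩ =>
      (-(r j : ℂ) * mulSgn s q) • sng ⟨r + p, xorE s q, .d0⟩
  | ⟨r, s, .d0⟩, ⟨p, q, .pa β⟩ =>
      (-(-1 : ℂ) ^ (gdeg s * (gdeg q + 1)) * derC β s * mulSgn q (derE β s)) •
          sng ⟨r + p, xorE q (derE β s), .d0⟩
  | ⟨_, _, .d0⟩, ⟨_, _, .d0⟩ => 0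

/-- A module over the Lie superalgebra `W(m,n)` (resp. `W(m,n) ⋉ A d_0`):
a complex vector space with a linear action satisfying the super commutator rule. -/
structure WRep (m n : ℕ) (b : Bool) where
  M : Type
  [addgrp : AddCommGroup M]
  [mods : Module ℂ M]
  act : W m n b →ₗ[ℂ] M →ₗ[ℂ] M
  super : ∀ x y : WBasis m n b,
    act (brB x y)
      = act (sng x) ∘ₗ act (sng y)
        - ((-1 : ℂ) ^ (par x * par y)) • (act (sng y) ∘ₗ act (sng x))

attribute [instance] WRep.addgrp WRep.mods

/-- A raw action of (the basis of) `W(m,n)` resp. `W(m,n) ⋉ A d_0` on a vector space. -/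
abbrev GAct (m n : ℕ) (b : Bool) (M : Type) [AddCommGroup M] [Module ℂ M] :=
  WBasis m n b → M →ₗ[ℂ] M

/-- Index set for the Cartan subalgebra `h'`: the elements `d_1, …, d_m`,
together with `d_0` when `b = true`. -/
abbrev HIdx (m : ℕ) (b : Bool) := Fin m ⊕ Fin (cond b 1 0)

def hB (m n : ℕ) (b : Bool) : HIdx m b → WBasis m n b :=
  fun h => match b, h with
    | _, .inl i => ⟨0, fun _ => false, .di i⟩
    | true, .inr _ => ⟨0, fun _ => false, .d0⟩
    | false, .inr j => j.elim0

/-- The basis element `ξ_a ∂_a` of the odd Cartan subalgebra `h''`. -/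
def hppB (m n : ℕ) (b : Bool) (a : Fin n) : WBasis m n b :=
  ⟨0, fun x => decide (x = a), .pa a⟩

section Predicates

variable {M : Type} [AddCommGroup M] [Module ℂ M] {b : Bool}

/-- Weight space with respect to the even Cartan subalgebra `h'`. -/
def wtG (F : GAct m n b M) (lam : HIdx m b → ℂ) : Submodule ℂ M :=
  ⨅ h, LinearMap.ker (F (hB m n b h) - lam h • (LinearMap.id : M →ₗ[ℂ] M))

/-- Weight space with respect to the full Cartan subalgebra `h = h' ⊕ h''`. -/
def wtFullG (F : GAct m n b M) (lam : HIdx m b → ℂ) (mu : Fin n → ℂ) : Submodule ℂ M :=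
  wtG F lam ⊓
    ⨅ a, LinearMap.ker (F (hppB m n b a) - mu a • (LinearMap.id : M →ₗ[ℂ] M))

/-- Strong Harish-Chandra module: weight decomposition with respect to `h'`
with finite-dimensional weight spaces. -/
def IsStrongHCG (F : GAct m n b M) : Prop :=
  (⨆ lam, wtG F lam) = ⊤ ∧ ∀ lam, FiniteDimensional ℂ (wtG F lam)

/-- Harish-Chandra module: weight decomposition with respect to `h`
with finite-dimensional weight spaces. -/
def IsHCG (F : GAct m n b M) : Prop :=
  (⨆ lam, ⨆ mu, wtFullG F lam mu) = ⊤ ∧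
    ∀ lam mu, FiniteDimensional ℂ (wtFullG F lam mu)

/-- Strongly cuspidal: strong Harish-Chandra with uniformly bounded multiplicities. -/
def IsStronglyCuspidalG (F : GAct m n b M) : Prop :=
  IsStrongHCG F ∧ ∃ C : ℕ, ∀ lam, Module.finrank ℂ (wtG F lam) ≤ C

/-- Cuspidal: Harish-Chandra with uniformly bounded weight multiplicities. -/
def IsCuspidalG (F : GAct m n b M) : Prop :=
  IsHCG F ∧ ∃ C : ℕ, ∀ lam mu, Module.finrank ℂ (wtFullG F lam mu) ≤ C

/-- The action of the odd Cartan subalgebra `h''` is diagonalizable. -/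
def DiagHppG (F : GAct m n b M) : Prop :=
  (⨆ mu : Fin n → ℂ,
    ⨅ a, LinearMap.ker (F (hppB m n b a) - mu a • (LinearMap.id : M →ₗ[ℂ] M))) = ⊤

def InvariantG (F : GAct m n b M) (N : Submodule ℂ M) : Prop :=
  ∀ x : WBasis m n b, ∀ v ∈ N, F x v ∈ N

/-- Simplicity of a module, phrased via invariant subspaces. -/
def IsSimpleG (F : GAct m n b M) : Prop :=
  (∃ v : M, v ≠ 0) ∧ ∀ N : Submodule ℂ M, InvariantG F N → N = ⊥ ∨ N = ⊤

end Predicates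

/-- The action of basis elements attached to a representation. -/
def WRep.g {b : Bool} (ρ : WRep m n b) : GAct m n b ρ.M := fun x => ρ.act (sng x)

end

end WSuper

namespace WSuper

noncomputable section

variable {m n : ℕ}

/-- Basis monomials `t^r ξ^s` of the supercommutative superalgebra `A = R_m ⊗ Λ`. -/
abbrev ABasis (m n : ℕ) := LExp m × GExp n

/-- The supercommutative superalgebra `A = R_m ⊗ Λ` as the free complex vector
space on its monomial basis. -/
abbrev AAlg (m n : ℕ) := ABasis m n →₀ ℂ

def asng (x : ABasis m n) : AAlg m n := Finsupp.single x 1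

def aone (m n : ℕ) : AAlg m n := asng (0, fun _ => false)

/-- Product of two monomials of `A`. -/
def amulB (x y : ABasis m n) : AAlg m n :=
  mulSgn x.2 y.2 • asng (x.1 + y.1, xorE x.2 y.2)

/-- Parity of a monomial of `A`. -/
def apar (x : ABasis m n) : ℕ := gdeg x.2 % 2

/-- The action of a basis element of `W(m,n)` (resp. `W(m,n) ⋉ A d_0`) on a
monomial of `A` by superderivations (`d_0` acts by zero on `A`). -/
def wOnA {b : Bool} : WBasis m n b → ABasis m n → AAlg m n
  | ⟨r, s, .di i⟩, ⟨p, q⟩ => ((p i : ℂ) * mulSgn s q) • asng (r + p, xorE s q)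
  | ⟨r, s, .pa α⟩, ⟨p, q⟩ =>
      (derC α q * mulSgn s (derE α q)) • asng (r + p, xorE s (derE α q))
  | ⟨_, _, .d0⟩, _ => 0

/-- An `AV`-module: compatible actions of the superalgebra `A` and of the Lie
superalgebra `V = W(m,n)` (resp. `W(m,n) ⋉ A d_0`), satisfying the Leibniz rule. -/
structure AVRep (m n : ℕ) (b : Bool) extends WRep m n b where
  aact : AAlg m n →ₗ[ℂ] M →ₗ[ℂ] M
  aact_one : aact (aone m n) = LinearMap.id
  aact_mul : ∀ x y : ABasis m n, aact (amulB x y) = aact (asng x) ∘ₗ aact (asng y)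
  leibniz : ∀ (x : WBasis m n b) (f : ABasis m n),
    act (sng x) ∘ₗ aact (asng f)
      = aact (wOnA x f)
        + ((-1 : ℂ) ^ (par x * apar f)) • (aact (asng f) ∘ₗ act (sng x))

/-- `M` is finitely generated as an `A`-module. -/
def IsFiniteRank {b : Bool} (ρ : AVRep m n b) : Prop :=
  ∃ S : Finset ρ.M,
    Submodule.span ℂ {v : ρ.M | ∃ f : ABasis m n, ∃ s ∈ S, v = ρ.aact (asng f) s} = ⊤

/-- A subspace invariant under both the `A`-action and the `V`-action. -/
def AVInvariant {b : Bool} (ρ : AVRep m n b) (N : Submodule ℂ ρ.M) : Prop :=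
  InvariantG ρ.g N ∧ ∀ f : ABasis m n, ∀ v ∈ N, ρ.aact (asng f) v ∈ N

/-- Irreducibility as an `AV`-module. -/
def AVIsSimple {b : Bool} (ρ : AVRep m n b) : Prop :=
  (∃ v : ρ.M, v ≠ 0) ∧ ∀ N : Submodule ℂ ρ.M, AVInvariant ρ N → N = ⊥ ∨ N = ⊤

/-- A weight module: weight decomposition with respect to `h'`. -/
def IsWeightG {M : Type} [AddCommGroup M] [Module ℂ M] {b : Bool}
    (F : GAct m n b M) : Prop :=
  (⨆ lam, wtG F lam) = ⊤

end

end WSuper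

namespace WSuper

noncomputable section

variable {m n : ℕ}

/-- A `ℤ/2`-graded module over `W(m,n)` resp. `W(m,n) ⋉ A d_0`. -/
structure SWRep (m n : ℕ) (b : Bool) extends WRep m n b where
  gr : ZMod 2 → Submodule ℂ M
  gr_span : ∀ v : M, ∃ v0 ∈ gr 0, ∃ v1 ∈ gr 1, v = v0 + v1
  gr_indep : ∀ v0 ∈ gr 0, ∀ v1 ∈ gr 1, v0 + v1 = 0 → v0 = 0 ∧ v1 = 0
  gr_act : ∀ (x : WBasis m n b) (p : ZMod 2), ∀ v ∈ gr p,
    act (sng x) v ∈ gr ((par x : ZMod 2) + p)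

/-- The coinduced space `Hom(A, M)`. -/
abbrev HomAM {b : Bool} (ρ : SWRep m n b) := AAlg m n →ₗ[ℂ] ρ.M

/-- The parity-`p` component of `Hom(A, M)`:
maps sending `A_q` into `M_{q+p}`. -/
def HgrS {b : Bool} (ρ : SWRep m n b) (p : ZMod 2) : Submodule ℂ (HomAM ρ) where
  carrier := {φ | ∀ g : ABasis m n, φ (asng g) ∈ ρ.gr (p + (apar g : ZMod 2))}
  add_mem' := by
    intro a b ha hb g
    simpa using (ρ.gr _).add_mem (ha g) (hb g)
  zero_mem' := by
    intro g
    simp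
  smul_mem' := by
    intro c a ha g
    simpa using (ρ.gr _).smul_mem c (ha g)

/-- Bilinear extension of the product of `A` to `AAlg`. -/
def amulA (f g : AAlg m n) : AAlg m n :=
  f.sum fun x a => g.sum fun y c => (a * c) • amulB x y

/-- Linear extension (in the second argument) of the derivation action of a
basis vector field on `A`. -/
def wOnAL {b : Bool} (x : WBasis m n b) (g : AAlg m n) : AAlg m n :=
  g.sum fun y c => c • wOnA x y

/-- Multiplication of a basis vector field by a monomial of `A`. -/
def amulW {b : Bool} (f : ABasis m n) (x : WBasis m n b) : W m n b :=
  mulSgn f.2 x.2.1 • sng (f.1 + x.1, xorE f.2 x.2.1, x.2.2)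

/-- The element `ψ(τ, v) ∈ Hom(A, M)`, `ψ(τ,v)(g) = (−1)^{(|τ|+|v|)|g|} (g τ) v`,
for a homogeneous `v` of parity `p`. -/
def psiEl {b : Bool} (ρ : SWRep m n b) (τ : WBasis m n b) (p : ZMod 2)
    (v : ρ.M) : HomAM ρ :=
  Finsupp.lsum ℂ fun g =>
    LinearMap.toSpanSingleton ℂ ρ.M
      (((-1 : ℂ) ^ ((par τ + p.val) * apar g)) • ρ.act (amulW g τ) v)

/-- The `AV`-cover `M̂ ⊆ Hom(A, M)`: the span of the elements `ψ(τ, v)`. -/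
def AVCover {b : Bool} (ρ : SWRep m n b) : Submodule ℂ (HomAM ρ) :=
  Submodule.span ℂ
    {φ : HomAM ρ | ∃ (τ : WBasis m n b) (p : ZMod 2) (v : ρ.M),
      v ∈ ρ.gr p ∧ φ = psiEl ρ τ p v}

end

end WSuper

namespace WSuper

noncomputable section

variable {m n : ℕ}

/-- The sign attached to a Boolean. -/
def bsgn (x : Bool) : ℂ := if x then -1 else 1

/-- The Grassmann exponent of the generator `ξ_a`. -/
def del (a : Fin n) : GExp n := fun x => decide (x = a)

/-- The reordering sign of `ξ^s ξ^q`, ignoring vanishing. -/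
def chi (s q : GExp n) : ℂ := (-1 : ℂ) ^ invCount s q

lemma chi_eq_prod (s q : GExp n) :
    chi s q = ∏ a, ∏ c, bsgn (s a && (q c && decide (c < a))) := by
  unfold chi invCount
  rw [← Finset.prod_product', ← Finset.prod_const, Finset.prod_filter]
  refine Finset.prod_congr rfl fun p _ => ?_
  simp [bsgn, Bool.and_eq_true]

lemma neg_one_pow_gdeg (s : GExp n) : (-1 : ℂ) ^ gdeg s = ∏ a, bsgn (s a) := by
  unfold gdeg
  rw [← Finset.prod_const, Finset.prod_filter]
  rfl

lemma chi_xorE_left (s q u : GExp n) : chi (xorE s q) u = chi s u * chi q u := by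
  simp only [chi_eq_prod, ← Finset.prod_mul_distrib]
  refine Finset.prod_congr rfl fun a _ => Finset.prod_congr rfl fun c _ => ?_
  unfold xorE
  cases s a <;> cases q a <;> cases u c <;> cases decide (c < a) <;> simp [bsgn]

lemma chi_xorE_right (s q u : GExp n) : chi s (xorE q u) = chi s q * chi s u := by
  simp only [chi_eq_prod, ← Finset.prod_mul_distrib]
  refine Finset.prod_congr rfl fun a _ => Finset.prod_congr rfl fun c _ => ?_
  unfold xorE
  cases s a <;> cases q c <;> cases u c <;> cases decide (c < a) <;> simp [bsgn]

lemma chi_mul_self (s q : GExp n) : chi s q * chi s q = 1 := by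
  unfold chi
  rw [← mul_pow]; simp

lemma neg_one_pow_gdeg_xorE (s q : GExp n) :
    (-1 : ℂ) ^ gdeg (xorE s q) = (-1) ^ gdeg s * (-1) ^ gdeg q := by
  simp only [neg_one_pow_gdeg, ← Finset.prod_mul_distrib]
  refine Finset.prod_congr rfl fun a _ => ?_
  unfold xorE
  cases s a <;> cases q a <;> simp [bsgn]

lemma chi_mul_chi_swap (s q : GExp n) :
    chi s q * chi q s * ∏ a, bsgn (s a && q a) = (-1) ^ (gdeg s * gdeg q) := by
  have h1 : (-1 : ℂ) ^ (gdeg s * gdeg q) = ∏ a, ∏ c, bsgn (s a && q c) := by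
    rw [mul_comm, pow_mul, neg_one_pow_gdeg, gdeg, ← Finset.prod_const, Finset.prod_filter]
    refine Finset.prod_congr rfl fun a _ => ?_
    cases s a <;> simp [bsgn]
  have h2 : ∏ a, bsgn (s a && q a) = ∏ a, ∏ c, bsgn (s a && (q c && decide (c = a))) := by
    refine Finset.prod_congr rfl fun a _ => ?_
    rw [Finset.prod_eq_single a]
    · simp
    · intro c _ hc
      simp [hc, bsgn]
    · simp
  have h3 : chi q s = ∏ a, ∏ c, bsgn (s a && (q c && decide (a < c))) := by
    rw [chi_eq_prod, Finset.prod_comm]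
    refine Finset.prod_congr rfl fun a _ => Finset.prod_congr rfl fun c _ => ?_
    cases s a <;> cases q c <;> simp
  rw [h1, h2, h3, chi_eq_prod]
  simp only [← Finset.prod_mul_distrib]
  refine Finset.prod_congr rfl fun a _ => Finset.prod_congr rfl fun c _ => ?_
  rcases lt_trichotomy c a with h | h | h
  · simp [h, h.ne, h.not_gt, bsgn]
  · simp [h, bsgn]
  · simp [h, h.ne', h.not_gt, bsgn]

lemma gdeg_del (a : Fin n) : gdeg (del a) = 1 := by
  simp [gdeg, del, Finset.filter_eq']

lemma chi_del_swap (a : Fin n) (s : GExp n) :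
    chi s (del a) = bsgn (s a) * (-1) ^ gdeg s * chi (del a) s := by
  have h := chi_mul_chi_swap s (del a)
  have h2 : ∏ c, bsgn (s c && del a c) = bsgn (s a) := by
    rw [Finset.prod_eq_single a]
    · simp [del]
    · intro c _ hc
      simp [del, hc, bsgn]
    · simp
  rw [h2, gdeg_del, mul_one] at h
  have h3 : bsgn (s a) * bsgn (s a) = 1 := by cases s a <;> simp [bsgn]
  have h4 := chi_mul_self (del a) s
  rw [← h]
  linear_combination (-chi s (del a)) * h3 - chi s (del a) * bsgn (s a) * bsgn (s a) * h4

lemma derC_eq (a : Fin n) (s : GExp n) : derC a s = if s a then chi (del a) s else 0 := by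
  have : chi (del a) s = (-1 : ℂ) ^ (Finset.univ.filter fun x => s x = true ∧ x < a).card := by
    rw [chi_eq_prod, Finset.prod_eq_single a, ← Finset.prod_const, Finset.prod_filter]
    · refine Finset.prod_congr rfl fun c _ => ?_
      simp [del, bsgn]
    · intro c _ hc
      simp [del, hc, bsgn]
    · simp
  rw [this]; rfl

lemma derE_eq {a : Fin n} {s : GExp n} (h : s a = true) : derE a s = xorE s (del a) := by
  funext x
  unfold derE xorE del
  by_cases hx : x = a
  · subst hx; simp [h]
  · simp [hx]

lemma mulSgn_eq (s q : GExp n) :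
    mulSgn s q = if ∃ a, s a = true ∧ q a = true then 0 else chi s q := rfl

lemma xorE_assoc (s q u : GExp n) : xorE (xorE s q) u = xorE s (xorE q u) := by
  funext x; simp [xorE]

lemma xorE_comm (s q : GExp n) : xorE s q = xorE q s := by
  funext x; simp [xorE, Bool.xor_comm]

lemma mulSgn_assoc (s q u : GExp n) :
    mulSgn s q * mulSgn (xorE s q) u = mulSgn q u * mulSgn s (xorE q u) := by
  simp only [mulSgn_eq]
  by_cases h1 : ∃ a, s a = true ∧ q a = true
  · rw [if_pos h1]
    by_cases h2 : ∃ a, q a = true ∧ u a = true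
    · simp [if_pos h2]
    · obtain ⟨a, ha, hb⟩ := h1
      have : ∃ a, s a = true ∧ xorE q u a = true :=
        ⟨a, ha, by
          have : u a = false := by
            by_contra hu
            exact h2 ⟨a, hb, by simpa using hu⟩
          simp [xorE, hb, this]⟩
      simp [if_pos this]
  · rw [if_neg h1]
    by_cases h2 : ∃ a, q a = true ∧ u a = true
    · rw [if_pos h2]
      obtain ⟨a, ha, hb⟩ := h2
      have : ∃ a, xorE s q a = true ∧ u a = true :=
        ⟨a, by
          have : s a = false := by
            by_contra hu
            exact h1 ⟨a, by simpa using hu, ha⟩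
          simp [xorE, ha, this], hb⟩
      simp [if_pos this]
    · rw [if_neg h2]
      have : (∃ a, xorE s q a = true ∧ u a = true) ↔ ∃ a, s a = true ∧ xorE q u a = true := by
        refine exists_congr fun a => ?_
        have h1' := not_exists.1 h1 a
        have h2' := not_exists.1 h2 a
        revert h1' h2'
        unfold xorE
        cases s a <;> cases q a <;> cases u a <;> simp
      rw [chi_xorE_left, chi_xorE_right]
      by_cases h3 : ∃ a, s a = true ∧ xorE q u a = true
      · rw [if_pos (this.2 h3), if_pos h3]; ring
      · rw [if_neg (fun h => h3 (this.1 h)), if_neg h3]; ring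

lemma mulSgn_comm (s q : GExp n) :
    mulSgn s q = (-1) ^ (gdeg s * gdeg q) * mulSgn q s := by
  simp only [mulSgn_eq]
  by_cases h : ∃ a, s a = true ∧ q a = true
  · rw [if_pos h, if_pos (by simpa only [and_comm] using h)]; ring
  · rw [if_neg h, if_neg (by simpa only [and_comm] using h), ← chi_mul_chi_swap,
      Finset.prod_eq_one]
    · linear_combination (-chi s q) * chi_mul_self q s
    · intro a _
      have := not_exists.1 h a
      revert this
      cases s a <;> cases q a <;> simp [bsgn]

lemma derC_derC (a c : Fin n) (s : GExp n) :
    derC a s * derC c (xorE s (del a)) = - (derC c s * derC a (xorE s (del c))) := by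
  simp only [derC_eq, chi_xorE_right]
  by_cases hac : a = c
  · subst hac
    cases h : s a <;> simp [xorE, del, h]
  · have h1 : xorE s (del a) c = s c := by simp [xorE, del, Ne.symm hac]
    have h2 : xorE s (del c) a = s a := by simp [xorE, del, hac]
    rw [h1, h2]
    have h3 := chi_del_swap c (del a)
    rw [gdeg_del, show bsgn (del a c) = 1 by simp [bsgn, del, Ne.symm hac]] at h3
    cases s a <;> cases s c <;> simp
    rw [h3]; ring

lemma derC_mulSgn (a : Fin n) (s q : GExp n) :
    mulSgn s q * derC a (xorE s q) =
      derC a s * mulSgn (xorE s (del a)) q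
        + (-1) ^ gdeg s * (derC a q * mulSgn s (xorE q (del a))) := by
  have hsw := chi_del_swap a s
  have hg : ((-1 : ℂ) ^ gdeg s) * (-1) ^ gdeg s = 1 := by rw [← mul_pow]; simp
  simp only [derC_eq, mulSgn_eq, chi_xorE_left, chi_xorE_right]
  have key : (∃ c, c ≠ a ∧ s c = true ∧ q c = true) ∨
      ∀ c, c ≠ a → s c = true → q c = false := by
    by_cases h : ∃ c, c ≠ a ∧ s c = true ∧ q c = true
    · exact Or.inl h
    · right
      intro c h1 h2
      by_contra h3
      exact h ⟨c, h1, h2, by simpa using h3⟩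
  have e1 : (∃ c, xorE s (del a) c = true ∧ q c = true) ↔
      (∃ c, c ≠ a ∧ s c = true ∧ q c = true) ∨ (s a = false ∧ q a = true) := by
    constructor
    · rintro ⟨c, h1, h2⟩
      by_cases hc : c = a
      · subst hc; right; simpa [xorE, del, h2] using h1
      · left; exact ⟨c, hc, by simpa [xorE, del, hc] using h1, h2⟩
    · rintro (⟨c, hc, h1, h2⟩ | ⟨h1, h2⟩)
      · exact ⟨c, by simpa [xorE, del, hc] using h1, h2⟩
      · exact ⟨a, by simp [xorE, del, h1], h2⟩
  have e2 : (∃ c, s c = true ∧ xorE q (del a) c = true) ↔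
      (∃ c, c ≠ a ∧ s c = true ∧ q c = true) ∨ (s a = true ∧ q a = false) := by
    constructor
    · rintro ⟨c, h1, h2⟩
      by_cases hc : c = a
      · subst hc; right; simpa [xorE, del, h1] using h2
      · left; exact ⟨c, hc, h1, by simpa [xorE, del, hc] using h2⟩
    · rintro (⟨c, hc, h1, h2⟩ | ⟨h1, h2⟩)
      · exact ⟨c, h1, by simpa [xorE, del, hc] using h2⟩
      · exact ⟨a, h1, by simp [xorE, del, h2]⟩
  have e3 : (∃ c, s c = true ∧ q c = true) ↔
      (∃ c, c ≠ a ∧ s c = true ∧ q c = true) ∨ (s a = true ∧ q a = true) := by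
    constructor
    · rintro ⟨c, h1, h2⟩
      by_cases hc : c = a
      · subst hc; exact Or.inr ⟨h1, h2⟩
      · exact Or.inl ⟨c, hc, h1, h2⟩
    · rintro (⟨c, hc, h⟩ | h)
      · exact ⟨c, h⟩
      · exact ⟨a, h⟩
  have e4 : xorE s q a = Bool.xor (s a) (q a) := rfl
  rw [e4]
  simp only [e1, e2, e3]
  by_cases hk : ∃ c, c ≠ a ∧ s c = true ∧ q c = true
  · simp [hk]
  · simp only [hk, false_or]
    cases hs : s a <;> cases hq : q a <;> simp [hs, bsgn] at hsw ⊢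
    · rw [hsw]
      linear_combination (-(chi (del a) q * chi s q * chi (del a) s)) * hg
    · ring
    · rw [hsw]
      linear_combination (chi (del a) q * chi s q * chi (del a) s) * hg

/-- Multiplication of `A`, as a bilinear map. -/
def mulA : AAlg m n →ₗ[ℂ] Module.End ℂ (AAlg m n) :=
  Finsupp.linearCombination ℂ fun x => Finsupp.linearCombination ℂ (amulB x)

/-- A direction acting on monomials of `A`. -/
def dirB {b : Bool} : Dir m n b → ABasis m n → AAlg m n
  | .di i, ⟨p, q⟩ => (p i : ℂ) • asng (p, q)
  | .pa α, ⟨p, q⟩ => derC α q • asng (p, xorE q (del α))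
  | .d0, _ => 0

/-- A direction acting on `A`. -/
def dirA {b : Bool} (D : Dir m n b) : Module.End ℂ (AAlg m n) :=
  Finsupp.linearCombination ℂ (dirB D)

/-- Parity of a direction. -/
def dpar {b : Bool} : Dir m n b → ℕ
  | .di _ => 0
  | .pa _ => 1
  | .d0 => 0

/-- The action of vector fields on `A`. -/
def wA {b : Bool} : W m n b →ₗ[ℂ] Module.End ℂ (AAlg m n) :=
  Finsupp.linearCombination ℂ fun x => Finsupp.linearCombination ℂ (wOnA x)

/-- The vector field `h D` for `h ∈ A` and a direction `D`. -/
def vec {b : Bool} (D : Dir m n b) : AAlg m n →ₗ[ℂ] W m n b :=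
  Finsupp.linearCombination ℂ fun x => sng (x.1, x.2, D)

lemma mulA_asng_asng (x y : ABasis m n) : mulA (asng x) (asng y) = amulB x y := by
  simp [mulA, asng]

lemma dirA_asng {b : Bool} (D : Dir m n b) (y : ABasis m n) : dirA D (asng y) = dirB D y := by
  simp [dirA, asng]

lemma wA_sng_asng {b : Bool} (x : WBasis m n b) (y : ABasis m n) :
    wA (sng x) (asng y) = wOnA x y := by
  simp [wA, asng, sng]

lemma vec_asng {b : Bool} (D : Dir m n b) (x : ABasis m n) :
    vec D (asng x) = sng (x.1, x.2, D) := by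
  simp [vec, asng]

lemma end_ext {F G : Module.End ℂ (AAlg m n)} (h : ∀ x, F (asng x) = G (asng x)) : F = G := by
  refine Finsupp.lhom_ext' fun x => LinearMap.ext_ring ?_
  exact h x

lemma amulA_eq (f g : AAlg m n) : amulA f g = mulA f g := by
  simp only [amulA, mulA, Finsupp.linearCombination_apply, Finsupp.sum, LinearMap.sum_apply,
    LinearMap.smul_apply, Finset.smul_sum, mul_smul]

lemma wOnAL_eq {b : Bool} (x : WBasis m n b) (g : AAlg m n) : wOnAL x g = wA (sng x) g := by
  simp [wOnAL, wA, sng, Finsupp.linearCombination_apply]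

lemma derC_smul_derE (a : Fin n) (q s : GExp n) (r : LExp m) :
    (derC a q * mulSgn s (derE a q)) • asng (r, xorE s (derE a q)) =
      (derC a q * mulSgn s (xorE q (del a))) • asng (r, xorE s (xorE q (del a))) := by
  cases h : q a
  · simp [derC_eq, h]
  · rw [derE_eq h]

lemma mulA_mul (f g : ABasis m n) : mulA (asng f) * mulA (asng g) = mulA (amulB f g) := by
  refine end_ext fun z => ?_
  rw [Module.End.mul_apply, mulA_asng_asng]
  simp only [amulB, map_smul, LinearMap.smul_apply, mulA_asng_asng, smul_smul, add_assoc,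
    xorE_assoc, mulSgn_assoc]

lemma mulA_mul_apply (f : ABasis m n) (h : AAlg m n) :
    mulA (asng f) * mulA h = mulA (mulA (asng f) h) := by
  induction h using Finsupp.induction_linear with
  | zero => simp
  | add x y hx hy => simp [mul_add, hx, hy]
  | single g c =>
    have : (Finsupp.single g c : AAlg m n) = c • asng g := by simp [asng]
    rw [this]
    simp only [map_smul, mul_smul_comm, mulA_mul, mulA_asng_asng]

lemma mulA_comm (f g : ABasis m n) :
    mulA (asng f) * mulA (asng g) =
      (-1 : ℂ) ^ (gdeg f.2 * gdeg g.2) • (mulA (asng g) * mulA (asng f)) := by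
  rw [mulA_mul, mulA_mul, ← map_smul]
  congr 1
  unfold amulB
  rw [mulSgn_comm f.2 g.2, xorE_comm, add_comm g.1, smul_smul]

lemma dirA_mul_mulA {b : Bool} (D : Dir m n b) (g : ABasis m n) :
    dirA D * mulA (asng g) =
      mulA (dirB D g) + (-1 : ℂ) ^ (dpar D * gdeg g.2) • (mulA (asng g) * dirA D) := by
  refine end_ext fun z => ?_
  obtain ⟨r, s⟩ := g
  obtain ⟨p, q⟩ := z
  simp only [Module.End.mul_apply, LinearMap.add_apply, LinearMap.smul_apply, mulA_asng_asng,
    dirA_asng]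
  cases D with
  | di i =>
    simp only [amulB, dirB, dpar, map_smul, LinearMap.smul_apply, mulA_asng_asng, dirA_asng,
      smul_smul, ← add_smul, Pi.add_apply, Int.cast_add]
    congr 1
    ring
  | pa a =>
    have e1 : xorE (xorE s (del a)) q = xorE (xorE s q) (del a) := by
      rw [xorE_assoc, xorE_comm (del a), xorE_assoc]
    simp only [amulB, dirB, dpar, map_smul, LinearMap.smul_apply, mulA_asng_asng, dirA_asng,
      smul_smul, e1, ← xorE_assoc, derC_mulSgn, one_mul, ← add_smul]
  | d0 => simp [dirB, amulB, dirA_asng]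

lemma dirA_comm {b : Bool} (D E : Dir m n b) :
    dirA D * dirA E = (-1 : ℂ) ^ (dpar D * dpar E) • (dirA E * dirA D) := by
  refine end_ext fun z => ?_
  obtain ⟨p, q⟩ := z
  have e1 (a c : Fin n) : xorE (xorE q (del a)) (del c) = xorE (xorE q (del c)) (del a) := by
    rw [xorE_assoc, xorE_comm (del a), xorE_assoc]
  cases D <;> cases E <;>
    simp only [Module.End.mul_apply, LinearMap.smul_apply, dirA_asng, dirB, dpar, map_smul,
      smul_smul, map_zero, smul_zero]
  · congr 1; ring
  · congr 1; ring
  · congr 1; ring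
  · rename_i a c
    rw [derC_derC c a, e1 c a]
    congr 1
    ring

lemma wOnA_eq {b : Bool} (r : LExp m) (s : GExp n) (D : Dir m n b) (g : ABasis m n) :
    wOnA (r, s, D) g = mulA (asng (r, s)) (dirB D g) := by
  obtain ⟨p, q⟩ := g
  cases D with
  | di i => simp only [wOnA, dirB, map_smul, mulA_asng_asng, amulB, smul_smul]
  | pa a => simp only [wOnA, dirB, map_smul, mulA_asng_asng, amulB, smul_smul, derC_smul_derE]
  | d0 => simp [wOnA, dirB]

lemma wA_sng {b : Bool} (r : LExp m) (s : GExp n) (D : Dir m n b) :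
    wA (sng (r, s, D)) = mulA (asng (r, s)) * dirA D := by
  refine end_ext fun z => ?_
  rw [wA_sng_asng, wOnA_eq, Module.End.mul_apply, dirA_asng]

lemma wA_vec {b : Bool} (D : Dir m n b) (h : AAlg m n) : wA (vec D h) = mulA h * dirA D := by
  induction h using Finsupp.induction_linear with
  | zero => simp
  | add x y hx hy => simp [add_mul, hx, hy]
  | single g c =>
    have : (Finsupp.single g c : AAlg m n) = c • asng g := by simp [asng]
    rw [this]
    simp only [map_smul, smul_mul_assoc, vec_asng, wA_sng]

lemma derC_smul_sng {b : Bool} (D : Dir m n b) (a : Fin n) (q s : GExp n) (r : LExp m) (c : ℂ) :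
    (c * derC a q * mulSgn s (derE a q)) • sng (r, xorE s (derE a q), D) =
      (c * derC a q * mulSgn s (xorE q (del a))) • sng (r, xorE s (xorE q (del a)), D) := by
  cases h : q a
  · simp [derC_eq, h]
  · rw [derE_eq h]

lemma derC_smul_sng' {b : Bool} (D : Dir m n b) (a : Fin n) (q s : GExp n) (r : LExp m) :
    (derC a q * mulSgn s (derE a q)) • sng (r, xorE s (derE a q), D) =
      (derC a q * mulSgn s (xorE q (del a))) • sng (r, xorE s (xorE q (del a)), D) := by
  simpa using derC_smul_sng D a q s r 1

lemma brB_eq {b : Bool} (r p : LExp m) (s q : GExp n) (D E : Dir m n b) :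
    brB (r, s, D) (p, q, E) = vec E (mulA (asng (r, s)) (dirB D (p, q)))
      - (-1 : ℂ) ^ ((gdeg s + dpar D) * (gdeg q + dpar E)) •
        vec D (mulA (asng (p, q)) (dirB E (r, s))) := by
  cases D <;> cases E <;>
    simp only [brB, dirB, dpar, map_smul, map_zero, mulA_asng_asng, amulB, vec_asng, smul_smul,
      derC_smul_sng, derC_smul_sng', smul_zero, zero_sub, sub_zero, add_comm p r, add_zero]
  · rw [mulSgn_comm s q, xorE_comm q s]
    module
  · module
  · module
  · module
  · rw [mulSgn_comm s q, xorE_comm q s]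
    module
  · module

lemma wA_mul_mulA {b : Bool} (x : WBasis m n b) (g : ABasis m n) :
    wA (sng x) * mulA (asng g) = mulA (wOnA x g)
      + (-1 : ℂ) ^ ((gdeg x.2.1 + dpar x.2.2) * gdeg g.2) • (mulA (asng g) * wA (sng x)) := by
  obtain ⟨r, s, D⟩ := x
  rw [wA_sng, wOnA_eq, mul_assoc, dirA_mul_mulA, mul_add, mulA_mul_apply, mul_smul_comm,
    ← mul_assoc, mulA_comm (r, s) g, smul_mul_assoc, smul_smul, ← pow_add, mul_assoc]
  congr 3
  ring

lemma wA_brB {b : Bool} (x y : WBasis m n b) :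
    wA (brB x y) = wA (sng x) * wA (sng y)
      - (-1 : ℂ) ^ ((gdeg x.2.1 + dpar x.2.2) * (gdeg y.2.1 + dpar y.2.2)) •
        (wA (sng y) * wA (sng x)) := by
  obtain ⟨r, s, D⟩ := x
  obtain ⟨p, q, E⟩ := y
  have hx : wA (sng (r, s, D)) * wA (sng (p, q, E)) =
      mulA (mulA (asng (r, s)) (dirB D (p, q))) * dirA E +
      (-1 : ℂ) ^ (dpar D * gdeg q) •
        (mulA (asng (r, s)) * mulA (asng (p, q)) * (dirA D * dirA E)) := by
    rw [wA_sng, wA_sng, mul_assoc, ← mul_assoc (dirA D), dirA_mul_mulA]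
    simp only [mul_add, add_mul, smul_mul_assoc, mul_smul_comm, ← mulA_mul_apply, mul_assoc]
  have hy : wA (sng (p, q, E)) * wA (sng (r, s, D)) =
      mulA (mulA (asng (p, q)) (dirB E (r, s))) * dirA D +
      (-1 : ℂ) ^ (dpar E * gdeg s) •
        (mulA (asng (p, q)) * mulA (asng (r, s)) * (dirA E * dirA D)) := by
    rw [wA_sng, wA_sng, mul_assoc, ← mul_assoc (dirA E), dirA_mul_mulA]
    simp only [mul_add, add_mul, smul_mul_assoc, mul_smul_comm, ← mulA_mul_apply, mul_assoc]
  rw [brB_eq, map_sub, map_smul, wA_vec, wA_vec, hx, hy, mulA_comm (r, s) (p, q), dirA_comm D E]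
  simp only [smul_mul_assoc, mul_smul_comm, smul_smul, smul_add]
  have : (-1 : ℂ) ^ (dpar D * gdeg q) * ((-1) ^ (dpar D * dpar E) * (-1) ^ (gdeg s * gdeg q)) =
      (-1) ^ ((gdeg s + dpar D) * (gdeg q + dpar E)) * (-1) ^ (dpar E * gdeg s) := by
    have h : ((-1 : ℂ) ^ (dpar E * gdeg s)) * (-1) ^ (dpar E * gdeg s) = 1 := by
      rw [← mul_pow]; simp
    rw [show (gdeg s + dpar D) * (gdeg q + dpar E) =
      gdeg s * gdeg q + dpar D * gdeg q + dpar E * gdeg s + dpar D * dpar E by ring]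
    simp only [pow_add]
    linear_combination (-(-1 : ℂ) ^ (dpar D * gdeg q) * ((-1) ^ (dpar D * dpar E) *
      (-1) ^ (gdeg s * gdeg q))) * h
  rw [this]
  abel

lemma neg_one_pow_mod_two_mul (a k : ℕ) : (-1 : ℂ) ^ (a % 2 * k) = (-1) ^ (a * k) := by
  rw [pow_mul, pow_mul, ← neg_one_pow_eq_pow_mod_two]

lemma par_eq {b : Bool} (x : WBasis m n b) : par x = (gdeg x.2.1 + dpar x.2.2) % 2 := by
  obtain ⟨r, s, _ | _ | _⟩ := x <;> rfl

lemma neg_one_pow_par_mul {b : Bool} (x : WBasis m n b) (k : ℕ) :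
    (-1 : ℂ) ^ (par x * k) = (-1) ^ ((gdeg x.2.1 + dpar x.2.2) * k) := by
  rw [par_eq, neg_one_pow_mod_two_mul]

lemma neg_one_pow_mul_apar (x : ABasis m n) (k : ℕ) :
    (-1 : ℂ) ^ (k * apar x) = (-1) ^ (k * gdeg x.2) := by
  rw [mul_comm, apar, neg_one_pow_mod_two_mul, mul_comm]

/-- The parity operator on `A`. -/
def signA : Module.End ℂ (AAlg m n) :=
  Finsupp.linearCombination ℂ fun x => (-1 : ℂ) ^ apar x • asng x

lemma neg_one_pow_apar (x : ABasis m n) : (-1 : ℂ) ^ apar x = (-1) ^ gdeg x.2 := by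
  rw [apar, ← neg_one_pow_eq_pow_mod_two]

lemma signA_asng (x : ABasis m n) : signA (asng x) = (-1 : ℂ) ^ apar x • asng x := by
  simp [signA, asng]

lemma signA_mul_self : (signA : Module.End ℂ (AAlg m n)) * signA = 1 := by
  refine end_ext fun z => ?_
  rw [Module.End.mul_apply, signA_asng, map_smul, signA_asng, smul_smul, ← mul_pow]
  simp

lemma signA_mul_mulA (f : ABasis m n) :
    signA * mulA (asng f) = (-1 : ℂ) ^ apar f • (mulA (asng f) * signA) := by
  refine end_ext fun z => ?_
  simp only [Module.End.mul_apply, LinearMap.smul_apply, mulA_asng_asng, signA_asng, amulB,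
    map_smul, smul_smul, neg_one_pow_apar, neg_one_pow_gdeg_xorE]
  congr 1
  ring

lemma signA_mul_dirA {b : Bool} (D : Dir m n b) :
    signA * dirA D = (-1 : ℂ) ^ dpar D • (dirA D * signA) := by
  refine end_ext fun z => ?_
  obtain ⟨p, q⟩ := z
  cases D <;> simp only [Module.End.mul_apply, LinearMap.smul_apply, dirA_asng, signA_asng, dirB,
    map_smul, smul_smul, neg_one_pow_apar, neg_one_pow_gdeg_xorE, gdeg_del, dpar, map_zero,
    smul_zero]
  all_goals
    congr 1
    ring

lemma signA_mul_wA {b : Bool} (x : WBasis m n b) :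
    signA * wA (sng x) = (-1 : ℂ) ^ par x • (wA (sng x) * signA) := by
  have h := neg_one_pow_par_mul x 1
  obtain ⟨r, s, D⟩ := x
  rw [mul_one, mul_one] at h
  rw [h, wA_sng, ← mul_assoc, signA_mul_mulA, smul_mul_assoc, mul_assoc, signA_mul_dirA,
    mul_smul_comm, smul_smul, neg_one_pow_apar, ← pow_add, mul_assoc]

lemma wA_sng_aone {b : Bool} (x : WBasis m n b) : wA (sng x) (aone m n) = 0 := by
  obtain ⟨r, s, D⟩ := x
  rw [aone, wA_sng_asng, wOnA_eq]
  cases D <;> simp [dirB, derC]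

lemma mulA_aone : mulA (aone m n) = 1 := by
  refine end_ext fun z => ?_
  rw [aone, mulA_asng_asng, Module.End.one_apply]
  have h : xorE (fun _ => false) z.2 = z.2 := by
    funext a
    simp [xorE]
  simp [amulB, mulSgn, invCount, h]

section Twist

variable {X Y : Type*} [AddCommGroup X] [Module ℂ X] [AddCommGroup Y] [Module ℂ Y]

/-- Postcomposition with an endomorphism of the target. -/
def postcomp : Module.End ℂ Y →ₗ[ℂ] Module.End ℂ (X →ₗ[ℂ] Y) :=
  LinearMap.mk₂ ℂ (fun R φ => R ∘ₗ φ)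
    (fun _ _ _ => LinearMap.add_comp _ _ _) (fun _ _ _ => LinearMap.smul_comp _ _ _)
    (fun _ _ _ => LinearMap.comp_add _ _ _) (fun _ _ _ => LinearMap.comp_smul _ _ _)

/-- Super-precomposition `φ ↦ (-1)^{|F||φ|} φ ∘ F` with an endomorphism `F` of the source, where
`S` and `T` are the parity operators of source and target. -/
def precomp (S : Module.End ℂ X) (T : Module.End ℂ Y) :
    Module.End ℂ X →ₗ[ℂ] Module.End ℂ (X →ₗ[ℂ] Y) :=
  LinearMap.mk₂ ℂ
    (fun F φ => (2⁻¹ : ℂ) • (φ ∘ₗ (F + S * F * S) + T ∘ₗ φ ∘ₗ (S * F - F * S)))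
    (fun F G φ => by
      simp only [mul_add, add_mul, LinearMap.comp_add, LinearMap.comp_sub]; module)
    (fun c F φ => by
      simp only [mul_smul_comm, smul_mul_assoc, LinearMap.comp_add, LinearMap.comp_sub,
        LinearMap.comp_smul]; module)
    (fun F φ ψ => by
      simp only [LinearMap.comp_add, LinearMap.comp_sub, LinearMap.add_comp]; module)
    (fun c F φ => by
      simp only [LinearMap.comp_add, LinearMap.comp_sub, LinearMap.smul_comp,
        LinearMap.comp_smul]; module)

lemma postcomp_apply (R : Module.End ℂ Y) (φ : X →ₗ[ℂ] Y) (v : X) :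
    postcomp R φ v = R (φ v) := rfl

lemma postcomp_mul (R Q : Module.End ℂ Y) :
    (postcomp (R * Q) : Module.End ℂ (X →ₗ[ℂ] Y)) = postcomp R * postcomp Q := rfl

variable {S : Module.End ℂ X} {T : Module.End ℂ Y}

lemma mul_pow_of_sign {R : Type*} [Ring R] [Algebra ℂ R] {s f : R} {k : ℕ}
    (h : s * f = (-1 : ℂ) ^ k • (f * s)) (l : ℕ) :
    s ^ l * f = (-1 : ℂ) ^ (l * k) • (f * s ^ l) := by
  induction l with
  | zero => simp
  | succ l ih =>
    rw [pow_succ, mul_assoc, h, mul_smul_comm, ← mul_assoc, ih, smul_mul_assoc, smul_smul,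
      mul_assoc, ← pow_add]
    congr 2
    ring

lemma precomp_apply (hS : S * S = 1) (hT : T * T = 1) {F : Module.End ℂ X} {k : ℕ}
    (hF : S * F = (-1 : ℂ) ^ k • (F * S)) (φ : X →ₗ[ℂ] Y) (v : X) :
    precomp S T F φ v = (T ^ k) (φ ((S ^ k) (F v))) := by
  change ((2⁻¹ : ℂ) • (φ ∘ₗ (F + S * F * S) + T ∘ₗ φ ∘ₗ (S * F - F * S))) v = _
  rcases Nat.even_or_odd k with hk | hk
  · rw [hk.neg_one_pow, one_smul] at hF
    obtain ⟨l, rfl⟩ := hk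
    rw [← two_mul, pow_mul, pow_mul, pow_two, pow_two, hS, hT, one_pow, one_pow, hF, mul_assoc,
      hS]
    simp only [mul_one, sub_self, LinearMap.comp_zero, add_zero, LinearMap.smul_apply,
      LinearMap.comp_apply, LinearMap.add_apply, map_add, Module.End.one_apply]
    module
  · rw [hk.neg_one_pow, neg_one_smul] at hF
    obtain ⟨l, rfl⟩ := hk
    have hF' : F * S = - (S * F) := by rw [hF, neg_neg]
    rw [pow_succ, pow_succ, pow_mul, pow_mul, pow_two, pow_two, hS, hT, one_pow, one_pow,
      mul_assoc, hF', mul_neg, ← mul_assoc, hS]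
    simp only [one_mul, add_neg_cancel, LinearMap.comp_zero, zero_add, LinearMap.smul_apply,
      LinearMap.comp_apply, sub_neg_eq_add,
      LinearMap.add_apply, map_add, Module.End.mul_apply]
    module

lemma precomp_mul (hS : S * S = 1) (hT : T * T = 1) {F G : Module.End ℂ X} {k l : ℕ}
    (hF : S * F = (-1 : ℂ) ^ k • (F * S)) (hG : S * G = (-1 : ℂ) ^ l • (G * S)) :
    precomp S T F * precomp S T G = (-1 : ℂ) ^ (k * l) • precomp S T (G * F) := by
  have hGF : S * (G * F) = (-1 : ℂ) ^ (k + l) • (G * F * S) := by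
    rw [← mul_assoc, hG, smul_mul_assoc, mul_assoc, hF, mul_smul_comm, smul_smul, ← pow_add,
      mul_assoc, add_comm]
  have hc : G * S ^ k = (-1 : ℂ) ^ (k * l) • (S ^ k * G) := by
    rw [mul_pow_of_sign hG, smul_smul, ← mul_pow]; simp
  ext φ v
  rw [LinearMap.smul_apply, LinearMap.smul_apply, Module.End.mul_apply,
    precomp_apply hS hT hF, precomp_apply hS hT hG, precomp_apply hS hT hGF,
    ← Module.End.mul_apply G, hc, LinearMap.smul_apply, map_smul, map_smul, map_smul, map_smul,
    Module.End.mul_apply, Module.End.mul_apply, ← Module.End.mul_apply (T ^ k), ← pow_add,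
    ← Module.End.mul_apply (S ^ l), ← pow_add, add_comm l k]

lemma postcomp_mul_precomp (hS : S * S = 1) (hT : T * T = 1) {F : Module.End ℂ X}
    {R : Module.End ℂ Y} {k l : ℕ}
    (hF : S * F = (-1 : ℂ) ^ k • (F * S)) (hR : T * R = (-1 : ℂ) ^ l • (R * T)) :
    postcomp R * precomp S T F = (-1 : ℂ) ^ (l * k) • (precomp S T F * postcomp R) := by
  have hc : R * T ^ k = (-1 : ℂ) ^ (l * k) • (T ^ k * R) := by
    rw [mul_pow_of_sign hR, smul_smul, mul_comm k l, ← mul_pow]; simp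
  ext φ v
  rw [LinearMap.smul_apply, LinearMap.smul_apply, Module.End.mul_apply, Module.End.mul_apply,
    postcomp_apply, precomp_apply hS hT hF, precomp_apply hS hT hF, ← Module.End.mul_apply R, hc]
  rfl

lemma precomp_apply_of_homogeneous (hS : S * S = 1) (hT : T * T = 1) {F : Module.End ℂ X} {k : ℕ}
    (hF : S * F = (-1 : ℂ) ^ k • (F * S)) {φ : X →ₗ[ℂ] Y} {p : ℕ}
    (hφ : ∀ v, T (φ (S v)) = (-1 : ℂ) ^ p • φ v) (v : X) :
    precomp S T F φ v = (-1 : ℂ) ^ (k * p) • φ (F v) := by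
  rw [precomp_apply hS hT hF]
  clear hF
  generalize F v = w
  induction k with
  | zero => simp
  | succ k ih =>
    rw [pow_succ T, pow_succ' S, Module.End.mul_apply, Module.End.mul_apply, hφ, map_smul, ih,
      smul_smul, ← pow_add]
    congr 2
    ring

end Twist

lemma exists_signM {b : Bool} (ρ : SWRep m n b) :
    ∃ T : Module.End ℂ ρ.M, T * T = 1 ∧
      (∀ p : ZMod 2, ∀ v ∈ ρ.gr p, T v = (-1 : ℂ) ^ p.val • v) ∧
      ∀ x : WBasis m n b,
        T * ρ.act (sng x) = (-1 : ℂ) ^ par x • (ρ.act (sng x) * T) := by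
  have hc : IsCompl (ρ.gr 0) (ρ.gr 1) := by
    constructor
    · rw [Submodule.disjoint_def]
      intro v h0 h1
      exact (ρ.gr_indep v h0 (-v) (neg_mem h1) (by simp)).1
    · rw [codisjoint_iff, eq_top_iff]
      intro v _
      obtain ⟨v0, h0, v1, h1, rfl⟩ := ρ.gr_span v
      exact Submodule.add_mem_sup h0 h1
  obtain ⟨T, h0, h1⟩ : ∃ T : Module.End ℂ ρ.M, (∀ v ∈ ρ.gr 0, T v = v) ∧
      ∀ v ∈ ρ.gr 1, T v = -v := by
    refine ⟨LinearMap.ofIsCompl hc (ρ.gr 0).subtype (-(ρ.gr 1).subtype), ?_, ?_⟩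
    · intro v hv
      exact LinearMap.ofIsCompl_apply_left hc ⟨v, hv⟩
    · intro v hv
      exact LinearMap.ofIsCompl_apply_right hc ⟨v, hv⟩
  have hg : ∀ p : ZMod 2, ∀ v ∈ ρ.gr p, T v = (-1 : ℂ) ^ p.val • v := by
    intro p v hv
    fin_cases p
    · exact (h0 v hv).trans (by simp [ZMod.val])
    · exact (h1 v hv).trans (by simp [ZMod.val])
  refine ⟨T, ?_, hg, ?_⟩
  · ext v
    obtain ⟨v0, hv0, v1, hv1, rfl⟩ := ρ.gr_span v
    simp [h0 v0 hv0, h1 v1 hv1]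
  · intro x
    have hh : ∀ p : ZMod 2, ∀ v ∈ ρ.gr p, (T * ρ.act (sng x)) v =
        ((-1 : ℂ) ^ par x • (ρ.act (sng x) * T)) v := by
      intro p v hv
      rw [Module.End.mul_apply, LinearMap.smul_apply, Module.End.mul_apply, hg p v hv,
        hg _ _ (ρ.gr_act x p v hv), map_smul, smul_smul, ← pow_add]
      congr 1
      rw [ZMod.val_add, ZMod.val_natCast, ← neg_one_pow_eq_pow_mod_two, pow_add, pow_add,
        ← neg_one_pow_eq_pow_mod_two]
    ext v
    obtain ⟨v0, hv0, v1, hv1, rfl⟩ := ρ.gr_span v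
    rw [map_add, map_add, hh _ _ hv0, hh _ _ hv1]

lemma sign_homogeneous {b : Bool} (ρ : SWRep m n b) {T : Module.End ℂ ρ.M}
    (hT : ∀ p : ZMod 2, ∀ v ∈ ρ.gr p, T v = (-1 : ℂ) ^ p.val • v) {p : ZMod 2} {φ : HomAM ρ}
    (hφ : φ ∈ HgrS ρ p) (v : AAlg m n) : T (φ (signA v)) = (-1 : ℂ) ^ p.val • φ v := by
  have : T ∘ₗ φ ∘ₗ signA = (-1 : ℂ) ^ p.val • φ := by
    refine Finsupp.lhom_ext' fun x => LinearMap.ext_ring ?_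
    change T (φ (signA (asng x))) = (-1 : ℂ) ^ p.val • φ (asng x)
    rw [signA_asng, map_smul, map_smul, hT _ _ (hφ x), smul_smul]
    congr 1
    rw [ZMod.val_add, ZMod.val_natCast, ← neg_one_pow_eq_pow_mod_two, pow_add,
      ← neg_one_pow_eq_pow_mod_two, mul_left_comm, ← mul_pow]
    simp
  exact LinearMap.congr_fun this v

end

end WSuper

namespace WSuper

/-- Let `M` be a (`ℤ/2`-graded) module over `V = W(m,n)`
(`b = false`) or `V = W(m,n) ⋉ A d_0` (`b = true`).  Then
(a) `Hom(A, M)` is an `AV`-module with the actions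
`(fφ)(g) = (−1)^{|f||φ|} φ(fg)` and `(ηφ)(g) = η·φ(g) − (−1)^{|η||φ|} φ(η(g))`
(for homogeneous `f`, `η`, `φ`), and
(b) the map `π : Hom(A,M) → M`, `π(φ) = φ(1)`, is a homomorphism of
`V`-modules. -/
theorem coinduced_is_AV_module (m n : ℕ) (b : Bool) (ρ : SWRep m n b) :
    ∃ (aA : AAlg m n →ₗ[ℂ] HomAM ρ →ₗ[ℂ] HomAM ρ)
      (aW : W m n b →ₗ[ℂ] HomAM ρ →ₗ[ℂ] HomAM ρ),
      -- the `A`-action is given by `(fφ)(g) = (−1)^{|f||φ|} φ(fg)`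
      (∀ (p : ZMod 2), ∀ φ ∈ HgrS ρ p, ∀ (f : ABasis m n) (g : AAlg m n),
        (aA (asng f) φ) g = ((-1 : ℂ) ^ (apar f * p.val)) • φ (amulA (asng f) g)) ∧
      -- the `V`-action is given by `(ηφ)(g) = η φ(g) − (−1)^{|η||φ|} φ(η(g))`
      (∀ (p : ZMod 2), ∀ φ ∈ HgrS ρ p, ∀ (x : WBasis m n b) (g : AAlg m n),
        (aW (sng x) φ) g
          = ρ.act (sng x) (φ g)
            - ((-1 : ℂ) ^ (par x * p.val)) • φ (wOnAL x g)) ∧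
      -- (a) these actions make `Hom(A, M)` an `AV`-module:
      -- the `V`-action is a representation of the Lie superalgebra `V`,
      (∀ x y : WBasis m n b,
        aW (brB x y)
          = aW (sng x) ∘ₗ aW (sng y)
            - ((-1 : ℂ) ^ (par x * par y)) • (aW (sng y) ∘ₗ aW (sng x))) ∧
      -- the `A`-action is unital and associative,
      aA (aone m n) = LinearMap.id ∧
      (∀ x y : ABasis m n, aA (amulB x y) = aA (asng x) ∘ₗ aA (asng y)) ∧
      -- and the two actions satisfy the Leibniz rule
      (∀ (x : WBasis m n b) (f : ABasis m n),
        aW (sng x) ∘ₗ aA (asng f)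
          = aA (wOnA x f)
            + ((-1 : ℂ) ^ (par x * apar f)) • (aA (asng f) ∘ₗ aW (sng x))) ∧
      -- (b) `π(φ) = φ(1)` is a homomorphism of `V`-modules
      (∀ (x : WBasis m n b) (φ : HomAM ρ),
        (aW (sng x) φ) (aone m n) = ρ.act (sng x) (φ (aone m n))) := by
  obtain ⟨T, hT, hTg, hTx⟩ := exists_signM ρ
  have hS := signA_mul_self (m := m) (n := n)
  have hA := signA_mul_mulA (m := m) (n := n)
  have hW := signA_mul_wA (m := m) (n := n) (b := b)
  refine ⟨precomp signA T ∘ₗ mulA, postcomp ∘ₗ ρ.act - precomp signA T ∘ₗ wA,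
    ?_, ?_, ?_, ?_, ?_, ?_, ?_⟩
  · intro p φ hφ f g
    rw [amulA_eq]
    exact precomp_apply_of_homogeneous hS hT (hA f) (sign_homogeneous ρ hTg hφ) g
  · intro p φ hφ x g
    rw [wOnAL_eq]
    exact congrArg (ρ.act (sng x) (φ g) - ·)
      (precomp_apply_of_homogeneous hS hT (hW x) (sign_homogeneous ρ hTg hφ) g)
  · intro x y
    simp only [LinearMap.sub_apply, LinearMap.comp_apply, ← Module.End.mul_eq_comp]
    have hxy := precomp_mul hS hT (hW x) (hW y)
    have hyx := precomp_mul hS hT (hW y) (hW x)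
    have h1 := postcomp_mul_precomp hS hT (hW y) (hTx x)
    have h2 := postcomp_mul_precomp hS hT (hW x) (hTx y)
    have hbr : precomp signA T (wA (brB x y)) = precomp signA T (wA (sng x) * wA (sng y))
        - (-1 : ℂ) ^ (par x * par y) • precomp signA T (wA (sng y) * wA (sng x)) := by
      rw [← map_smul, ← map_sub, wA_brB, neg_one_pow_par_mul, mul_comm _ (par y), neg_one_pow_par_mul, mul_comm]
    have hact : ρ.act (brB x y) = ρ.act (sng x) * ρ.act (sng y)
        - (-1 : ℂ) ^ (par x * par y) • (ρ.act (sng y) * ρ.act (sng x)) := ρ.super x y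
    rw [mul_comm (par y)] at hyx h2
    simp only [sub_mul, mul_sub, hbr, hact, map_sub, map_smul, postcomp_mul, hxy, hyx, h1, h2]
    rcases neg_one_pow_eq_or ℂ (par x * par y) with h | h <;> rw [h] <;> module
  · rw [LinearMap.comp_apply, mulA_aone]
    refine LinearMap.ext fun φ => LinearMap.ext fun g => ?_
    rw [precomp_apply hS hT (k := 0) (by simp)]
    simp
  · intro x y
    simp only [LinearMap.comp_apply, ← Module.End.mul_eq_comp]
    rw [precomp_mul hS hT (hA x) (hA y), ← mulA_mul, mulA_comm, map_smul, neg_one_pow_mul_apar,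
      mul_comm (apar x), neg_one_pow_mul_apar, mul_comm]
  · intro x f
    simp only [LinearMap.sub_apply, LinearMap.comp_apply, ← Module.End.mul_eq_comp]
    have hxf := precomp_mul hS hT (hW x) (hA f)
    have hfx := precomp_mul hS hT (hA f) (hW x)
    have h1 := postcomp_mul_precomp hS hT (hA f) (hTx x)
    have hl := wA_mul_mulA x f
    rw [← neg_one_pow_par_mul, ← neg_one_pow_mul_apar] at hl
    rw [mul_comm (apar f)] at hfx
    simp only [sub_mul, mul_sub, hxf, hfx, h1, hl, map_add, map_smul]
    rcases neg_one_pow_eq_or ℂ (par x * apar f) with h | h <;> rw [h] <;> module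
  · intro x φ
    change ρ.act (sng x) (φ (aone m n)) - precomp signA T (wA (sng x)) φ (aone m n) = _
    rw [precomp_apply hS hT (hW x), wA_sng_aone]
    simp

end WSuper
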